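/- Let ξ ≠ 0 and η > 0, set λ₁ = ξ + iη and λ₂ = −conj(λ₁), let a₁₁, a₂₁ be complex constants, not both zero, and set a₁₂ = conj(a₁₁), a₂₂ = conj(a₂₁). Define the phases θ₁(x,t) = iλ₁(x + 4λ₁²t) and θ₂(x,t) = iλ₂(x + 4λ₂²t) (so θ₂ = conj(θ₁)), and the 2×2 matrix Ω(x,t) with entries Ω_{kj} = (conj(a_{1k})a_{1j} e^{conj(θ_k)+θ_j} + conj(a_{2k})a_{2j} e^{−conj(θ_k)−θ_j})/(conj(λ_k) − λ_j). Assume det Ω(x,t) ≠ 0 for every (x,t) ∈ ℝ². Then the function u(x,t) = −2i Σ_{j,k=1}^2 a_{1k} conj(a_{2j}) e^{θ_k − conj(θ_j)} (Ω(x,t)⁻¹)_{kj} is real-valued, smooth, and satisfies the mKdV equation u_t + u_xxx + 6u²u_x = 0 at every point of ℝ². -/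

import Mathlib

open Matrix BigOperators

/-- `n`-th `x`-derivative of the Hirota numerator when `p' = l p`, `q' = -l q`, `r' = m r`,
`s' = -m s`. -/
noncomputable def breatherNum (l m : ℂ) (n : ℕ) (p q r s : ℂ) : ℂ :=
  4 * (l + m) * (l - m) * (m * (r * s) * ((2 * l) ^ n * p ^ 2 + (-(2 * l)) ^ n * q ^ 2)
    - l * (p * q) * ((2 * m) ^ n * r ^ 2 + (-(2 * m)) ^ n * s ^ 2))

/-- `n`-th `x`-derivative of the Hirota denominator when `p' = l p`, `q' = -l q`, `r' = m r`,
`s' = -m s`. -/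
noncomputable def breatherDen (l m : ℂ) (n : ℕ) (p q r s : ℂ) : ℂ :=
  -(l - m) ^ 2 * ((2 * (l + m)) ^ n * (p * r) ^ 2 + (-(2 * (l + m))) ^ n * (q * s) ^ 2)
    + 8 * l * m * 0 ^ n * (p * q * r * s)
    - (l + m) ^ 2 * ((2 * (l - m)) ^ n * (p * s) ^ 2 + (-(2 * (l - m))) ^ n * (q * r) ^ 2)

/-- `t`-derivative of `breatherNum l m 0`. -/
noncomputable def breatherNumT (l m p q r s : ℂ) : ℂ :=
  -32 * (l + m) * (l - m) * (m * (r * s) * l ^ 3 * (p ^ 2 - q ^ 2)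
    - l * (p * q) * m ^ 3 * (r ^ 2 - s ^ 2))

/-- `t`-derivative of `breatherDen l m 0`. -/
noncomputable def breatherDenT (l m p q r s : ℂ) : ℂ :=
  8 * (l - m) ^ 2 * (l ^ 3 + m ^ 3) * ((p * r) ^ 2 - (q * s) ^ 2)
    + 8 * (l + m) ^ 2 * (l ^ 3 - m ^ 3) * ((p * s) ^ 2 - (q * r) ^ 2)

theorem breather_bilinear_sq (l m p q r s : ℂ) :
    breatherDen l m 0 p q r s * breatherDen l m 2 p q r s - breatherDen l m 1 p q r s ^ 2
      = breatherNum l m 0 p q r s ^ 2 := by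
  simp only [breatherDen, breatherNum]
  ring

theorem breather_bilinear_evolution (l m p q r s : ℂ) :
    breatherNumT l m p q r s * breatherDen l m 0 p q r s
      - breatherNum l m 0 p q r s * breatherDenT l m p q r s
      + breatherNum l m 3 p q r s * breatherDen l m 0 p q r s
      - 3 * breatherNum l m 2 p q r s * breatherDen l m 1 p q r s
      + 3 * breatherNum l m 1 p q r s * breatherDen l m 2 p q r s
      - breatherNum l m 0 p q r s * breatherDen l m 3 p q r s = 0 := by
  simp only [breatherDen, breatherNum, breatherDenT, breatherNumT]
  ring

section Derivatives

variable {p q r s : ℝ → ℂ} {l m : ℂ} {y : ℝ}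

theorem hasDerivAt_breatherNum (n : ℕ)
    (hp : HasDerivAt p (l * p y) y) (hq : HasDerivAt q (-l * q y) y)
    (hr : HasDerivAt r (m * r y) y) (hs : HasDerivAt s (-m * s y) y) :
    HasDerivAt (fun z => breatherNum l m n (p z) (q z) (r z) (s z))
      (breatherNum l m (n + 1) (p y) (q y) (r y) (s y)) y := by
  unfold breatherNum
  refine HasDerivAt.congr_deriv (((((hr.mul hs).const_mul m).mul
    (((hp.pow 2).const_mul ((2 * l) ^ n)).add
    ((hq.pow 2).const_mul ((-(2 * l)) ^ n)))).sub (((hp.mul hq).const_mul l).mul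
    (((hr.pow 2).const_mul ((2 * m) ^ n)).add
    ((hs.pow 2).const_mul ((-(2 * m)) ^ n))))).const_mul (4 * (l + m) * (l - m))) ?_
  simp only [pow_succ _ n]
  dsimp
  ring

theorem hasDerivAt_breatherDen (n : ℕ)
    (hp : HasDerivAt p (l * p y) y) (hq : HasDerivAt q (-l * q y) y)
    (hr : HasDerivAt r (m * r y) y) (hs : HasDerivAt s (-m * s y) y) :
    HasDerivAt (fun z => breatherDen l m n (p z) (q z) (r z) (s z))
      (breatherDen l m (n + 1) (p y) (q y) (r y) (s y)) y := by
  unfold breatherDen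
  refine HasDerivAt.congr_deriv ((((((((hp.mul hr).pow 2).const_mul ((2 * (l + m)) ^ n)).add
    (((hq.mul hs).pow 2).const_mul ((-(2 * (l + m))) ^ n))).const_mul (-(l - m) ^ 2)).add
    ((((hp.mul hq).mul hr).mul hs).const_mul (8 * l * m * 0 ^ n))).sub
    (((((hp.mul hs).pow 2).const_mul ((2 * (l - m)) ^ n)).add
    (((hq.mul hr).pow 2).const_mul ((-(2 * (l - m))) ^ n))).const_mul ((l + m) ^ 2)))) ?_
  simp only [pow_succ _ n]
  dsimp
  ring

theorem hasDerivAt_breatherNum_time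
    (hp : HasDerivAt p (-4 * l ^ 3 * p y) y) (hq : HasDerivAt q (4 * l ^ 3 * q y) y)
    (hr : HasDerivAt r (-4 * m ^ 3 * r y) y) (hs : HasDerivAt s (4 * m ^ 3 * s y) y) :
    HasDerivAt (fun z => breatherNum l m 0 (p z) (q z) (r z) (s z))
      (breatherNumT l m (p y) (q y) (r y) (s y)) y := by
  unfold breatherNum breatherNumT
  refine HasDerivAt.congr_deriv (((((hr.mul hs).const_mul m).mul
    (((hp.pow 2).const_mul ((2 * l) ^ 0)).add
    ((hq.pow 2).const_mul ((-(2 * l)) ^ 0)))).sub (((hp.mul hq).const_mul l).mul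
    (((hr.pow 2).const_mul ((2 * m) ^ 0)).add
    ((hs.pow 2).const_mul ((-(2 * m)) ^ 0))))).const_mul (4 * (l + m) * (l - m))) ?_
  dsimp
  ring

theorem hasDerivAt_breatherDen_time
    (hp : HasDerivAt p (-4 * l ^ 3 * p y) y) (hq : HasDerivAt q (4 * l ^ 3 * q y) y)
    (hr : HasDerivAt r (-4 * m ^ 3 * r y) y) (hs : HasDerivAt s (4 * m ^ 3 * s y) y) :
    HasDerivAt (fun z => breatherDen l m 0 (p z) (q z) (r z) (s z))
      (breatherDenT l m (p y) (q y) (r y) (s y)) y := by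
  unfold breatherDen breatherDenT
  refine HasDerivAt.congr_deriv ((((((((hp.mul hr).pow 2).const_mul ((2 * (l + m)) ^ 0)).add
    (((hq.mul hs).pow 2).const_mul ((-(2 * (l + m))) ^ 0))).const_mul (-(l - m) ^ 2)).add
    ((((hp.mul hq).mul hr).mul hs).const_mul (8 * l * m * 0 ^ 0))).sub
    (((((hp.mul hs).pow 2).const_mul ((2 * (l - m)) ^ 0)).add
    (((hq.mul hr).pow 2).const_mul ((-(2 * (l - m))) ^ 0))).const_mul ((l + m) ^ 2)))) ?_
  dsimp
  ring

end Derivatives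

theorem contDiff_breatherNum {E : Type*} [NormedAddCommGroup E] [NormedSpace ℝ E]
    {p q r s : E → ℂ} {k : WithTop ℕ∞} (l m : ℂ) (n : ℕ) (hp : ContDiff ℝ k p) (hq : ContDiff ℝ k q)
    (hr : ContDiff ℝ k r) (hs : ContDiff ℝ k s) :
    ContDiff ℝ k fun z => breatherNum l m n (p z) (q z) (r z) (s z) := by
  unfold breatherNum
  fun_prop

theorem contDiff_breatherDen {E : Type*} [NormedAddCommGroup E] [NormedSpace ℝ E]
    {p q r s : E → ℂ} {k : WithTop ℕ∞} (l m : ℂ) (n : ℕ) (hp : ContDiff ℝ k p) (hq : ContDiff ℝ k q)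
    (hr : ContDiff ℝ k r) (hs : ContDiff ℝ k s) :
    ContDiff ℝ k fun z => breatherDen l m n (p z) (q z) (r z) (s z) := by
  unfold breatherDen
  fun_prop

/-- If `G n` and `F n` are the successive `x`-derivatives of `G 0` and `F 0`, the Hirota bilinear
equations imply the mKdV equation for `G 0 / F 0`. -/
theorem mKdV_of_bilinear {G F : ℕ → ℝ → ℂ} {g f : ℝ → ℂ} {g' f' : ℂ} {x t : ℝ}
    (hG : ∀ n y, HasDerivAt (G n) (G (n + 1) y) y) (hF : ∀ n y, HasDerivAt (F n) (F (n + 1) y) y)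
    (hF0 : ∀ y, F 0 y ≠ 0)
    (hg : HasDerivAt g g' t) (hf : HasDerivAt f f' t) (hgt : g t = G 0 x) (hft : f t = F 0 x)
    (hsq : F 0 x * F 2 x - F 1 x ^ 2 = G 0 x ^ 2)
    (hev : g' * F 0 x - G 0 x * f' + G 3 x * F 0 x - 3 * G 2 x * F 1 x + 3 * G 1 x * F 2 x
      - G 0 x * F 3 x = 0)
    {u v : ℝ → ℝ} (hu : ∀ y, (u y : ℂ) = G 0 y / F 0 y) (hv : ∀ z, (v z : ℂ) = g z / f z) :
    deriv v t + iteratedDeriv 3 u x + 6 * u x ^ 2 * deriv u x = 0 := by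
  have re_deriv {w : ℝ → ℝ} {h : ℝ → ℂ} {h' : ℂ} {y : ℝ} (hh : HasDerivAt h h' y)
      (hw : ∀ z, (w z : ℂ) = h z) : HasDerivAt w h'.re y ∧ (h'.re : ℂ) = h' := by
    have e : h = fun z => (w z : ℂ) := funext fun z => (hw z).symm
    have hre := Complex.reCLM.hasFDerivAt.comp_hasDerivAt y hh
    have hw' : HasDerivAt w h'.re y := by
      rw [e] at hre
      exact hre
    refine ⟨hw', ?_⟩
    rw [e] at hh
    exact hw'.ofReal_comp.unique hh
  have h1 (y : ℝ) : HasDerivAt (fun z => G 0 z / F 0 z)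
      ((G 1 y * F 0 y - G 0 y * F 1 y) / F 0 y ^ 2) y := (hG 0 y).div (hF 0 y) (hF0 y)
  have h2 (y : ℝ) : HasDerivAt (fun z => (G 1 z * F 0 z - G 0 z * F 1 z) / F 0 z ^ 2)
      (((G 2 y * F 0 y - G 0 y * F 2 y) * F 0 y - 2 * F 1 y * (G 1 y * F 0 y - G 0 y * F 1 y))
        / F 0 y ^ 3) y := by
    have hy := hF0 y
    refine HasDerivAt.congr_deriv ((((hG 1 y).mul (hF 0 y)).sub ((hG 0 y).mul (hF 1 y))).div
      ((hF 0 y).pow 2) (pow_ne_zero 2 (hF0 y))) ?_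
    dsimp
    field_simp
    ring
  have h3 := (((((hG 2 x).mul (hF 0 x)).sub ((hG 0 x).mul (hF 2 x))).mul (hF 0 x)).sub
    (((hF 1 x).const_mul 2).mul (((hG 1 x).mul (hF 0 x)).sub ((hG 0 x).mul (hF 1 x))))).div
    ((hF 0 x).pow 3) (pow_ne_zero 3 (hF0 x))
  have r1 (y : ℝ) := re_deriv (h1 y) hu
  have r2 (y : ℝ) := re_deriv (h2 y) (fun z => (r1 z).2)
  have r3 := re_deriv h3 (fun z => (r2 z).2)
  have rt := re_deriv (hg.div hf (by rw [hft]; exact hF0 x)) hv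
  rw [iteratedDeriv_succ, iteratedDeriv_succ, iteratedDeriv_one, funext fun y => (r1 y).1.deriv,
    funext fun y => (r2 y).1.deriv, r3.1.deriv, rt.1.deriv, ← Complex.ofReal_inj]
  simp only [Complex.ofReal_add, Complex.ofReal_mul, Complex.ofReal_pow, hu]
  rw [rt.2, r3.2, (r1 x).2, hgt, hft]
  have hx := hF0 x
  dsimp
  linear_combination (norm := (field_simp; ring)) hev / F 0 x ^ 2
    - 6 * (G 1 x * F 0 x - G 0 x * F 1 x) / F 0 x ^ 4 * hsq

/-- The reflectionless formula in terms of the components `p = a₁ e^θ`, `q = a₂ e^{-θ}`,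
their conjugates `r`, `s`, and `l = iλ`, `m = conj l`. -/
theorem breather_quotient {l m p q r s : ℂ} (hl : l ≠ 0) (hm : m ≠ 0) (hlm : l + m ≠ 0)
    {M : Matrix (Fin 2) (Fin 2) ℂ} (hM : M.det ≠ 0)
    (h00 : M 0 0 = (r * p + s * q) / (Complex.I * (l + m)))
    (h01 : M 0 1 = (r * r + s * s) / (2 * Complex.I * m))
    (h10 : M 1 0 = (p * p + q * q) / (2 * Complex.I * l))
    (h11 : M 1 1 = (p * r + q * s) / (Complex.I * (l + m))) :
    breatherDen l m 0 p q r s ≠ 0 ∧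
    -2 * Complex.I * (p * s * M⁻¹ 0 0 + r * s * M⁻¹ 1 0 + (p * q * M⁻¹ 0 1 + r * q * M⁻¹ 1 1))
      = breatherNum l m 0 p q r s / breatherDen l m 0 p q r s := by
  have hI := Complex.I_ne_zero
  have hI2 := Complex.I_sq
  have hden : breatherDen l m 0 p q r s = -4 * l * m * (l + m) ^ 2 * M.det := by
    rw [Matrix.det_fin_two, h00, h01, h10, h11, breatherDen]
    field_simp
    rw [hI2]
    ring
  have hden0 : breatherDen l m 0 p q r s ≠ 0 := by
    rw [hden]
    simp [hl, hm, hlm, hM]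
  refine ⟨hden0, ?_⟩
  rw [eq_div_iff hden0, hden, Matrix.inv_def, Matrix.adjugate_fin_two, Ring.inverse_eq_inv']
  simp only [Matrix.smul_apply, smul_eq_mul, Matrix.of_apply, Matrix.cons_val', Matrix.cons_val_zero,
    Matrix.cons_val_one, Matrix.cons_val_fin_one]
  rw [h00, h01, h10, h11, breatherNum]
  generalize M.det = d at hM ⊢
  field_simp
  ring

/-- The reflectionless formula with a pair of eigenvalues
`λ₁ = ξ + iη ∈ ℂ⁺ \ iℝ⁺`, `λ₂ = -conj(λ₁)` and conjugate norming constants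
produces a real-valued smooth (breather) solution of the mKdV equation
`u_t + u_xxx + 6u²u_x = 0`. -/
theorem breather_mKdV
    (ξ η : ℝ) (hξ : ξ ≠ 0) (hη : 0 < η)
    (lam : Fin 2 → ℂ)
    (hlam0 : lam 0 = (ξ : ℂ) + (η : ℂ) * Complex.I)
    (hlam1 : lam 1 = -(starRingEnd ℂ) (lam 0))
    (a1 a2 : Fin 2 → ℂ)
    (ha : ¬(a1 0 = 0 ∧ a2 0 = 0))
    (ha1 : a1 1 = (starRingEnd ℂ) (a1 0))
    (ha2 : a2 1 = (starRingEnd ℂ) (a2 0))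
    (θ : Fin 2 → ℝ → ℝ → ℂ)
    (hθ : ∀ j x t, θ j x t = Complex.I * lam j * ((x : ℂ) + 4 * (lam j) ^ 2 * (t : ℂ)))
    (Ω : ℝ → ℝ → Matrix (Fin 2) (Fin 2) ℂ)
    (hΩ : ∀ x t k j, Ω x t k j =
      ((starRingEnd ℂ) (a1 k) * a1 j * Complex.exp ((starRingEnd ℂ) (θ k x t) + θ j x t)
        + (starRingEnd ℂ) (a2 k) * a2 j *
            Complex.exp (-(starRingEnd ℂ) (θ k x t) - θ j x t)) /
        ((starRingEnd ℂ) (lam k) - lam j))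
    (hdet : ∀ x t : ℝ, (Ω x t).det ≠ 0)
    (U : ℝ → ℝ → ℂ)
    (hU : ∀ x t, U x t = -2 * Complex.I *
      ∑ j, ∑ k, a1 k * (starRingEnd ℂ) (a2 j) *
        Complex.exp (θ k x t - (starRingEnd ℂ) (θ j x t)) * (Ω x t)⁻¹ k j) :
    (∀ x t : ℝ, (U x t).im = 0) ∧
    ContDiff ℝ (⊤ : ℕ∞) (fun p : ℝ × ℝ => (U p.1 p.2).re) ∧
    ∀ x t : ℝ,
      deriv (fun t' => (U x t').re) t
        + iteratedDeriv 3 (fun x' => (U x' t).re) x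
        + 6 * ((U x t).re) ^ 2 * deriv (fun x' => (U x' t).re) x = 0 := by
  set l : ℂ := Complex.I * lam 0 with hl_def
  set m : ℂ := (starRingEnd ℂ) l with hm_def
  have hm_eq : m = -(Complex.I * (starRingEnd ℂ) (lam 0)) := by simp [hm_def, hl_def]
  have hl : l ≠ 0 := mul_ne_zero Complex.I_ne_zero fun h => hη.ne' (by
    simpa [hlam0] using congrArg Complex.im h)
  have hm : m ≠ 0 := by simpa [hm_def] using hl
  have hlm_eq : l + m = -2 * η := by
    rw [hm_eq, hl_def, hlam0]
    simp only [map_add, map_mul, Complex.conj_ofReal, Complex.conj_I]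
    linear_combination 2 * (η : ℂ) * Complex.I_sq
  have hlm : l + m ≠ 0 := by
    rw [hlm_eq]
    simpa using hη.ne'
  let φ (x t : ℝ) : ℂ := l * x - 4 * l ^ 3 * t
  let ψ (x t : ℝ) : ℂ := m * x - 4 * m ^ 3 * t
  have hθ0 (x t : ℝ) : θ 0 x t = φ x t := by
    simp only [hθ, φ, hl_def]
    linear_combination (4 * Complex.I * lam 0 ^ 3 * t) * Complex.I_sq
  have hconj (x t : ℝ) : (starRingEnd ℂ) (φ x t) = ψ x t := by
    simp only [φ, ψ, hm_def, map_sub, map_mul, map_pow, map_ofNat, Complex.conj_ofReal]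
  have hconj' (x t : ℝ) : (starRingEnd ℂ) (ψ x t) = φ x t := by
    rw [← hconj, Complex.conj_conj]
  have hθ1 (x t : ℝ) : θ 1 x t = ψ x t := by
    simp only [hθ, ψ, hm_eq, hlam1]
    linear_combination (-4 * Complex.I * (starRingEnd ℂ) (lam 0) ^ 3 * t) * Complex.I_sq
  let p (x t : ℝ) : ℂ := a1 0 * Complex.exp (φ x t)
  let q (x t : ℝ) : ℂ := a2 0 * Complex.exp (-φ x t)
  let r (x t : ℝ) : ℂ := (starRingEnd ℂ) (a1 0) * Complex.exp (ψ x t)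
  let s (x t : ℝ) : ℂ := (starRingEnd ℂ) (a2 0) * Complex.exp (-ψ x t)
  have key (x t : ℝ) : breatherDen l m 0 (p x t) (q x t) (r x t) (s x t) ≠ 0 ∧
      U x t = breatherNum l m 0 (p x t) (q x t) (r x t) (s x t) /
        breatherDen l m 0 (p x t) (q x t) (r x t) (s x t) := by
    have hden0 : (starRingEnd ℂ) (lam 0) - lam 0 = Complex.I * (l + m) := by
      rw [hm_eq, hl_def]
      linear_combination ((starRingEnd ℂ) (lam 0) - lam 0) * Complex.I_sq
    have hden1 : (starRingEnd ℂ) (lam 0) - lam 1 = 2 * Complex.I * m := by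
      rw [hm_eq, hlam1]
      linear_combination (2 * (starRingEnd ℂ) (lam 0)) * Complex.I_sq
    have hden2 : (starRingEnd ℂ) (lam 1) - lam 0 = 2 * Complex.I * l := by
      rw [hl_def, hlam1, map_neg, Complex.conj_conj]
      linear_combination (-2 * lam 0) * Complex.I_sq
    have hden3 : (starRingEnd ℂ) (lam 1) - lam 1 = Complex.I * (l + m) := by
      rw [← hden0, hlam1, map_neg, Complex.conj_conj]
      ring
    have h := breather_quotient (p := p x t) (q := q x t) (r := r x t) (s := s x t) hl hm hlm
      (hdet x t)
      (by
        rw [hΩ, hden0, hθ0, hconj, sub_eq_add_neg, Complex.exp_add, Complex.exp_add]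
        simp only [p, q, r, s]
        ring)
      (by
        rw [hΩ, hden1, hθ0, hθ1, hconj, ha1, ha2, sub_eq_add_neg, Complex.exp_add, Complex.exp_add]
        simp only [r, s]
        ring)
      (by
        rw [hΩ, hden2, hθ0, hθ1, hconj', ha1, ha2, Complex.conj_conj, Complex.conj_conj,
          sub_eq_add_neg, Complex.exp_add, Complex.exp_add]
        simp only [p, q]
        ring)
      (by
        rw [hΩ, hden3, hθ1, hconj', ha1, ha2, Complex.conj_conj, Complex.conj_conj,
          sub_eq_add_neg, Complex.exp_add, Complex.exp_add]
        simp only [p, q, r, s]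
        ring)
    refine ⟨h.1, ?_⟩
    rw [← h.2, hU]
    simp only [Fin.sum_univ_two, hθ0, hθ1, hconj, hconj', ha1, ha2, Complex.conj_conj,
      sub_eq_add_neg, Complex.exp_add, p, q, r, s]
    ring
  have him (x t : ℝ) : (U x t).im = 0 := by
    rw [← Complex.conj_eq_iff_im, (key x t).2]
    have hp : (starRingEnd ℂ) (p x t) = r x t := by simp [p, r, ← Complex.exp_conj, hconj]
    have hq : (starRingEnd ℂ) (q x t) = s x t := by simp [q, s, ← Complex.exp_conj, hconj]
    have hr : (starRingEnd ℂ) (r x t) = p x t := by rw [← hp, Complex.conj_conj]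
    have hs : (starRingEnd ℂ) (s x t) = q x t := by rw [← hq, Complex.conj_conj]
    have hl' : (starRingEnd ℂ) l = m := rfl
    have hm' : (starRingEnd ℂ) m = l := Complex.conj_conj l
    rw [map_div₀]
    congr 1
    · simp only [breatherNum, map_mul, map_add, map_sub, map_pow, map_neg, map_ofNat, hp, hq, hr,
        hs, hl', hm']
      ring
    · simp only [breatherDen, map_mul, map_add, map_sub, map_pow, map_neg, map_ofNat, map_zero,
        hp, hq, hr, hs, hl', hm']
      ring
  have hcoe (x t : ℝ) : ((U x t).re : ℂ) = U x t := Complex.ext rfl (him x t).symm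
  refine ⟨him, ?_, fun x t => ?_⟩
  · have hof : ContDiff ℝ (⊤ : ℕ∞) ((↑) : ℝ → ℂ) := Complex.ofRealCLM.contDiff
    have hx : ContDiff ℝ (⊤ : ℕ∞) fun z : ℝ × ℝ => (z.1 : ℂ) := hof.comp contDiff_fst
    have ht : ContDiff ℝ (⊤ : ℕ∞) fun z : ℝ × ℝ => (z.2 : ℂ) := hof.comp contDiff_snd
    have hφ : ContDiff ℝ (⊤ : ℕ∞) fun z : ℝ × ℝ => φ z.1 z.2 := by fun_prop
    have hψ : ContDiff ℝ (⊤ : ℕ∞) fun z : ℝ × ℝ => ψ z.1 z.2 := by fun_prop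
    have hp : ContDiff ℝ (⊤ : ℕ∞) fun z : ℝ × ℝ => p z.1 z.2 := contDiff_const.mul hφ.cexp
    have hq : ContDiff ℝ (⊤ : ℕ∞) fun z : ℝ × ℝ => q z.1 z.2 := contDiff_const.mul hφ.neg.cexp
    have hr : ContDiff ℝ (⊤ : ℕ∞) fun z : ℝ × ℝ => r z.1 z.2 := contDiff_const.mul hψ.cexp
    have hs : ContDiff ℝ (⊤ : ℕ∞) fun z : ℝ × ℝ => s z.1 z.2 := contDiff_const.mul hψ.neg.cexp
    refine Complex.reCLM.contDiff.comp (?_ : ContDiff ℝ (⊤ : ℕ∞) fun z : ℝ × ℝ => U z.1 z.2)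
    rw [show (fun z : ℝ × ℝ => U z.1 z.2) = _ from funext fun z => (key z.1 z.2).2]
    simp only [div_eq_mul_inv]
    exact (contDiff_breatherNum l m 0 hp hq hr hs).mul
      ((contDiff_breatherDen l m 0 hp hq hr hs).inv fun z => (key z.1 z.2).1)
  · have hφx (y : ℝ) : HasDerivAt (fun z => φ z t) l y :=
      (((hasDerivAt_id y).ofReal_comp.const_mul l).sub_const (4 * l ^ 3 * t)).congr_deriv
        (by simp)
    have hψx (y : ℝ) : HasDerivAt (fun z => ψ z t) m y :=
      (((hasDerivAt_id y).ofReal_comp.const_mul m).sub_const (4 * m ^ 3 * t)).congr_deriv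
        (by simp)
    have hφt : HasDerivAt (fun z => φ x z) (-(4 * l ^ 3)) t := by
      simpa using ((hasDerivAt_id t).ofReal_comp.const_mul (4 * l ^ 3)).const_sub (l * x)
    have hψt : HasDerivAt (fun z => ψ x z) (-(4 * m ^ 3)) t := by
      simpa using ((hasDerivAt_id t).ofReal_comp.const_mul (4 * m ^ 3)).const_sub (m * x)
    have hexp {h : ℝ → ℂ} {h' c d : ℂ} {y : ℝ} (hh : HasDerivAt h h' y) (hd : d = h') :
        HasDerivAt (fun z => c * Complex.exp (h z)) (d * (c * Complex.exp (h y))) y :=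
      (hh.cexp.const_mul c).congr_deriv (by rw [hd]; ring)
    have hpx (y : ℝ) : HasDerivAt (fun z => p z t) (l * p y t) y := hexp (hφx y) rfl
    have hqx (y : ℝ) : HasDerivAt (fun z => q z t) (-l * q y t) y := hexp (hφx y).neg rfl
    have hrx (y : ℝ) : HasDerivAt (fun z => r z t) (m * r y t) y := hexp (hψx y) rfl
    have hsx (y : ℝ) : HasDerivAt (fun z => s z t) (-m * s y t) y := hexp (hψx y).neg rfl
    have hpt : HasDerivAt (fun z => p x z) (-4 * l ^ 3 * p x t) t := hexp hφt (by ring)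
    have hqt : HasDerivAt (fun z => q x z) (4 * l ^ 3 * q x t) t := hexp hφt.neg (by ring)
    have hrt : HasDerivAt (fun z => r x z) (-4 * m ^ 3 * r x t) t := hexp hψt (by ring)
    have hst : HasDerivAt (fun z => s x z) (4 * m ^ 3 * s x t) t := hexp hψt.neg (by ring)
    clear_value p q r s l m
    exact mKdV_of_bilinear
      (G := fun n z => breatherNum l m n (p z t) (q z t) (r z t) (s z t))
      (F := fun n z => breatherDen l m n (p z t) (q z t) (r z t) (s z t))
      (fun n y => hasDerivAt_breatherNum n (hpx y) (hqx y) (hrx y) (hsx y))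
      (fun n y => hasDerivAt_breatherDen n (hpx y) (hqx y) (hrx y) (hsx y))
      (fun y => (key y t).1)
      (hasDerivAt_breatherNum_time hpt hqt hrt hst)
      (hasDerivAt_breatherDen_time hpt hqt hrt hst) rfl rfl
      (breather_bilinear_sq l m _ _ _ _) (breather_bilinear_evolution l m _ _ _ _)
      (fun y => (hcoe y t).trans (key y t).2) (fun z => (hcoe x z).trans (key x z).2)
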